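/- Let p, q be probability vectors on Fin d. Then the following are equivalent: (1) for every ε > 0 there exists a probability vector p' on Fin d with ∑ i, |p' i − p i| < ε, and there exist m₁, m₂, m₃ ≥ 1 and a probability distribution r on Fin m₁ × Fin m₂ × Fin m₃ such that p' ⊗ r ≺ q ⊗ (r₁ ⊗ r₂ ⊗ r₃), where r₁, r₂, r₃ are the marginals of r; (2) H(q) ≤ H(p). -/

import Mathlib

open Finset

/-- max over finsets of card k of the sum of entries -/
noncomputable def maxSum {ι : Type*} [Fintype ι] (p : ι → ℝ) (k : ℕ) : ℝ :=
  sSup {x : ℝ | ∃ S : Finset ι, S.card = k ∧ x = ∑ i ∈ S, p i}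

/-- majorization: equal total sums, and for each k the max k-term partial sum
of `p` is at most that of `q`. -/
def Maj {ι : Type*} [Fintype ι] (p q : ι → ℝ) : Prop :=
  (∑ i, p i = ∑ i, q i) ∧ ∀ k : ℕ, maxSum p k ≤ maxSum q k

/-- a probability vector: nonnegative entries summing to one -/
def IsProbVec {ι : Type*} [Fintype ι] (p : ι → ℝ) : Prop :=
  (∀ i, 0 ≤ p i) ∧ ∑ i, p i = 1

/-- tensor product of two vectors -/
def tensor {ι κ : Type*} (p : ι → ℝ) (r : κ → ℝ) : ι × κ → ℝ :=
  fun x => p x.1 * r x.2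

/-- Shannon entropy (with `0 * log 0 = 0` automatic since `Real.log 0 = 0`) -/
noncomputable def shannon {ι : Type*} [Fintype ι] (p : ι → ℝ) : ℝ :=
  -∑ i, p i * Real.log (p i)

/-- first marginal of a tripartite distribution -/
noncomputable def marg₁ {m₁ m₂ m₃ : ℕ} (r : Fin m₁ × Fin m₂ × Fin m₃ → ℝ) : Fin m₁ → ℝ :=
  fun i => ∑ j, ∑ k, r (i, j, k)

/-- second marginal of a tripartite distribution -/
noncomputable def marg₂ {m₁ m₂ m₃ : ℕ} (r : Fin m₁ × Fin m₂ × Fin m₃ → ℝ) : Fin m₂ → ℝ :=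
  fun j => ∑ i, ∑ k, r (i, j, k)

/-- third marginal of a tripartite distribution -/
noncomputable def marg₃ {m₁ m₂ m₃ : ℕ} (r : Fin m₁ × Fin m₂ × Fin m₃ → ℝ) : Fin m₃ → ℝ :=
  fun k => ∑ i, ∑ j, r (i, j, k)

/-- product of the three marginals of a tripartite distribution -/
noncomputable def prodMarg {m₁ m₂ m₃ : ℕ} (r : Fin m₁ × Fin m₂ × Fin m₃ → ℝ) :
    Fin m₁ × Fin m₂ × Fin m₃ → ℝ :=
  fun x => marg₁ r x.1 * (marg₂ r x.2.1 * marg₃ r x.2.2)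

lemma finite_maxSum_set {ι : Type*} [Fintype ι] (p : ι → ℝ) (k : ℕ) :
    {x : ℝ | ∃ S : Finset ι, S.card = k ∧ x = ∑ i ∈ S, p i}.Finite := by
  classical
  refine (Set.finite_range fun S : Finset ι => ∑ i ∈ S, p i).subset ?_
  rintro x ⟨S, -, rfl⟩
  exact ⟨S, rfl⟩

lemma sum_le_maxSum {ι : Type*} [Fintype ι] (p : ι → ℝ) (S : Finset ι) :
    ∑ i ∈ S, p i ≤ maxSum p S.card :=
  le_csSup (finite_maxSum_set p _).bddAbove ⟨S, rfl, rfl⟩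

lemma exists_sum_eq_maxSum {ι : Type*} [Fintype ι] (p : ι → ℝ) {k : ℕ}
    (hk : k ≤ Fintype.card ι) :
    ∃ S : Finset ι, S.card = k ∧ maxSum p k = ∑ i ∈ S, p i := by
  obtain ⟨S, -, hS⟩ := Finset.exists_subset_card_eq (s := (univ : Finset ι)) hk
  have hne : {x : ℝ | ∃ S : Finset ι, S.card = k ∧ x = ∑ i ∈ S, p i}.Nonempty := ⟨_, S, hS, rfl⟩
  exact hne.csSup_mem (finite_maxSum_set p k)

/-- The sum of the positive parts of `p i - t`. Majorization is equivalent to comparing these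
sums for all `t` together with equality of the total sums. -/
noncomputable def hingeSum {ι : Type*} [Fintype ι] (p : ι → ℝ) (t : ℝ) : ℝ :=
  ∑ i, max (p i - t) 0

lemma sum_sub_le_hingeSum {ι : Type*} [Fintype ι] (p : ι → ℝ) (t : ℝ) (S : Finset ι) :
    ∑ i ∈ S, p i - S.card * t ≤ hingeSum p t := by
  calc ∑ i ∈ S, p i - S.card * t = ∑ i ∈ S, (p i - t) := by
        simp [Finset.sum_sub_distrib]
    _ ≤ ∑ i ∈ S, max (p i - t) 0 := Finset.sum_le_sum fun i _ => le_max_left _ _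
    _ ≤ hingeSum p t :=
        Finset.sum_le_sum_of_subset_of_nonneg (Finset.subset_univ _)
          fun i _ _ => le_max_right _ _

lemma Maj.hingeSum_le {ι : Type*} [Fintype ι] {p q : ι → ℝ} (h : Maj p q) (t : ℝ) :
    hingeSum p t ≤ hingeSum q t := by
  classical
  set S : Finset ι := univ.filter fun i => t < p i with hS
  have hpS : hingeSum p t = ∑ i ∈ S, p i - S.card * t := by
    have : ∑ i ∈ S, p i - S.card * t = ∑ i ∈ S, (p i - t) := by
      simp [Finset.sum_sub_distrib]
    rw [this, hS, Finset.sum_filter, hingeSum]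
    refine Finset.sum_congr rfl fun i _ => ?_
    split_ifs with hi
    · exact max_eq_left (by linarith)
    · exact max_eq_right (by linarith)
  obtain ⟨S', hS', hmax⟩ := exists_sum_eq_maxSum q (Finset.card_le_univ S)
  have h1 := (sum_le_maxSum p S).trans (h.2 S.card)
  have h2 := sum_sub_le_hingeSum q t S'
  rw [hS'] at h2
  linarith

lemma exists_threshold {ι : Type*} [Fintype ι] (q : ι → ℝ) {k : ℕ}
    (hk : k ≤ Fintype.card ι) (hk0 : 0 < k) :
    ∃ t : ℝ, maxSum q k = k * t + hingeSum q t := by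
  classical
  obtain ⟨S, hS, hmax⟩ := exists_sum_eq_maxSum q hk
  have hne : S.Nonempty := Finset.card_pos.mp (hS ▸ hk0)
  obtain ⟨a, haS, ha⟩ := S.exists_min_image q hne
  have hoff : ∀ j ∉ S, q j ≤ q a := by
    intro j hj
    have h1 := sum_le_maxSum q (insert j (S.erase a))
    have hj' : j ∉ S.erase a := fun h => hj (Finset.mem_of_mem_erase h)
    have hcard : (insert j (S.erase a)).card = k := by
      rw [Finset.card_insert_of_notMem hj', Finset.card_erase_of_mem haS, hS]
      omega
    rw [hcard, hmax, Finset.sum_insert hj', ← Finset.add_sum_erase S q haS] at h1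
    linarith
  refine ⟨q a, ?_⟩
  have h2 : hingeSum q (q a) = ∑ i ∈ S, (q i - q a) := by
    rw [hingeSum, ← Finset.sum_subset (Finset.subset_univ S)]
    · exact Finset.sum_congr rfl fun i hi => max_eq_left (by linarith [ha i hi])
    · intro i _ hi
      exact max_eq_right (by linarith [hoff i hi])
  rw [h2, hmax, Finset.sum_sub_distrib, Finset.sum_const, hS, nsmul_eq_mul]
  ring

lemma maj_of_hingeSum_le {ι : Type*} [Fintype ι] {p q : ι → ℝ}
    (hsum : ∑ i, p i = ∑ i, q i) (h : ∀ t, hingeSum p t ≤ hingeSum q t) : Maj p q := by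
  refine ⟨hsum, fun k => ?_⟩
  by_cases hk : k ≤ Fintype.card ι
  · obtain ⟨S, hS, hmax⟩ := exists_sum_eq_maxSum p hk
    rcases Nat.eq_zero_or_pos k with rfl | hk0
    · rw [hmax, Finset.card_eq_zero.mp hS]
      simpa using sum_le_maxSum q (∅ : Finset ι)
    · obtain ⟨t, ht⟩ := exists_threshold q hk hk0
      have h1 := sum_sub_le_hingeSum p t S
      rw [hS] at h1
      linarith [h t]
  · have hempty : ∀ r : ι → ℝ, maxSum r k = 0 := by
      intro r
      have : {x : ℝ | ∃ S : Finset ι, S.card = k ∧ x = ∑ i ∈ S, r i} = ∅ := by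
        ext x
        simp only [Set.mem_ofPred_eq, Set.mem_empty_iff_false, iff_false]
        rintro ⟨S, hS, -⟩
        exact hk (hS ▸ Finset.card_le_univ S)
      rw [maxSum, this, Real.sSup_empty]
    rw [hempty, hempty]

lemma hingeSum_mul {ι : Type*} [Fintype ι] (p : ι → ℝ) {c : ℝ} (hc : 0 < c) (t : ℝ) :
    hingeSum (fun i => c * p i) t = c * hingeSum p (t / c) := by
  rw [hingeSum, hingeSum, Finset.mul_sum]
  refine Finset.sum_congr rfl fun i _ => ?_
  rw [mul_max_of_nonneg _ _ hc.le, mul_zero, mul_sub, mul_div_cancel₀ _ hc.ne']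

lemma hingeSum_mul_le {ι : Type*} [Fintype ι] {p q : ι → ℝ}
    (h : ∀ t, hingeSum p t ≤ hingeSum q t) {c : ℝ} (hc : 0 ≤ c) (t : ℝ) :
    hingeSum (fun i => c * p i) t ≤ hingeSum (fun i => c * q i) t := by
  rcases hc.eq_or_lt with rfl | hc
  · simp
  · rw [hingeSum_mul p hc, hingeSum_mul q hc]
    exact mul_le_mul_of_nonneg_left (h _) hc.le

/-- Replacing the entries on a set by their average decreases sums of positive parts. -/
lemma card_mul_hinge_average_le {ι : Type*} (T : Finset ι) (q : ι → ℝ) (t : ℝ) :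
    (T.card : ℝ) * max ((∑ i ∈ T, q i) / T.card - t) 0 ≤ ∑ i ∈ T, max (q i - t) 0 := by
  rcases T.eq_empty_or_nonempty with rfl | hT
  · simp
  have hT' : (0 : ℝ) < T.card := by exact_mod_cast Finset.card_pos.mpr hT
  rw [mul_max_of_nonneg _ _ hT'.le, mul_zero, mul_sub, mul_div_cancel₀ _ hT'.ne']
  refine max_le ?_ (Finset.sum_nonneg fun i _ => le_max_right _ _)
  calc ∑ i ∈ T, q i - T.card * t = ∑ i ∈ T, (q i - t) := by simp [Finset.sum_sub_distrib]
    _ ≤ _ := Finset.sum_le_sum fun i _ => le_max_left _ _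

lemma IsProbVec.le_one {ι : Type*} [Fintype ι] {p : ι → ℝ} (hp : IsProbVec p) (i : ι) :
    p i ≤ 1 := by
  rw [← hp.2]
  exact Finset.single_le_sum (fun i _ => hp.1 i) (Finset.mem_univ i)

lemma intervalIntegrable_hinge_div {m : ℝ} (hm : 0 < m) {a b : ℝ} (ha : m ≤ a) (hab : a ≤ b)
    (x : ℝ) :
    IntervalIntegrable (fun t => max (x - t) 0 / t) MeasureTheory.volume a b := by
  refine ContinuousOn.intervalIntegrable ?_
  rw [Set.uIcc_of_le hab]
  exact ContinuousOn.div (by fun_prop) continuousOn_id fun t ht =>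
    (hm.trans_le (ha.trans ht.1)).ne'

lemma integral_hinge_div_of_le {m x : ℝ} (hm1 : m ≤ 1) (hx : x ≤ m) :
    ∫ t in m..1, max (x - t) 0 / t = 0 := by
  rw [← intervalIntegral.integral_zero (a := m) (b := 1) (μ := MeasureTheory.volume) (E := ℝ)]
  refine intervalIntegral.integral_congr fun t ht => ?_
  rw [Set.uIcc_of_le hm1] at ht
  simp [max_eq_right (show x - t ≤ 0 by linarith [ht.1])]

lemma integral_hinge_div_of_ge {m x : ℝ} (hm : 0 < m) (hx : m ≤ x) (hx1 : x ≤ 1) :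
    ∫ t in m..1, max (x - t) 0 / t = x * (Real.log x - Real.log m) - (x - m) := by
  rw [← intervalIntegral.integral_add_adjacent_intervals
    (intervalIntegrable_hinge_div hm le_rfl hx x) (intervalIntegrable_hinge_div hm hx hx1 x),
    integral_hinge_div_of_le hx1 le_rfl, add_zero]
  have h1 : ∫ t in m..x, max (x - t) 0 / t = ∫ t in m..x, (x * t⁻¹ - 1) := by
    refine intervalIntegral.integral_congr fun t ht => ?_
    rw [Set.uIcc_of_le hx] at ht
    have ht0 : t ≠ 0 := (hm.trans_le ht.1).ne'
    simp only [max_eq_left (show 0 ≤ x - t by linarith [ht.2])]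
    field_simp
  have hnot : (0 : ℝ) ∉ Set.uIcc m x := by
    rw [Set.uIcc_of_le hx]
    exact fun h => absurd h.1 (not_le.mpr hm)
  have hint : IntervalIntegrable (fun t : ℝ => x * t⁻¹) MeasureTheory.volume m x := by
    refine (ContinuousOn.intervalIntegrable ?_).const_mul x
    exact continuousOn_id.inv₀ fun t ht h => hnot (h ▸ ht)
  rw [h1, intervalIntegral.integral_sub hint (by simp), intervalIntegral.integral_const_mul,
    integral_inv hnot, Real.log_div (hm.trans_le hx).ne' hm.ne']
  simp

lemma mul_log_le_integral_hinge {m x : ℝ} (hm : 0 < m) (hm1 : m ≤ 1) (hx0 : 0 ≤ x)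
    (hx1 : x ≤ 1) :
    x * Real.log x ≤ (∫ t in m..1, max (x - t) 0 / t) + x * (Real.log m + 1) := by
  rcases le_total x m with h | h
  · rw [integral_hinge_div_of_le hm1 h]
    rcases hx0.eq_or_lt with rfl | hx0
    · simp
    · nlinarith [Real.log_le_log hx0 h]
  · rw [integral_hinge_div_of_ge hm h hx1]
    nlinarith

lemma integral_hinge_le_mul_log {m x : ℝ} (hm : 0 < m) (hm1 : m ≤ 1) (hx0 : 0 ≤ x)
    (hx1 : x ≤ 1) :
    (∫ t in m..1, max (x - t) 0 / t) + x * (Real.log m + 1) ≤ x * Real.log x + m := by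
  rcases le_total x m with h | h
  · rw [integral_hinge_div_of_le hm1 h]
    rcases hx0.eq_or_lt with rfl | hx0
    · simpa using hm.le
    · have h1 := Real.log_le_sub_one_of_pos (div_pos hm hx0)
      rw [Real.log_div hm.ne' hx0.ne'] at h1
      have h2 := mul_le_mul_of_nonneg_left h1 hx0.le
      rw [mul_sub, mul_sub, mul_div_cancel₀ _ hx0.ne'] at h2
      linarith
  · rw [integral_hinge_div_of_ge hm h hx1]
    linarith

/-- Shannon entropy is Schur-concave. -/
lemma shannon_le_of_hingeSum_le {ι : Type*} [Fintype ι] {p q : ι → ℝ} (hp : IsProbVec p)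
    (hq : IsProbVec q) (h : ∀ t, hingeSum p t ≤ hingeSum q t) : shannon q ≤ shannon p := by
  have key : ∀ m : ℝ, 0 < m → m ≤ 1 →
      ∑ i, p i * Real.log (p i) ≤ ∑ i, q i * Real.log (q i) + Fintype.card ι * m := by
    intro m hm hm1
    have hF : ∀ r : ι → ℝ, ∑ i, ∫ t in m..1, max (r i - t) 0 / t =
        ∫ t in m..1, hingeSum r t / t := by
      intro r
      rw [← intervalIntegral.integral_finsetSum fun i _ =>
        intervalIntegrable_hinge_div hm le_rfl hm1 (r i)]
      simp only [hingeSum, Finset.sum_div]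
    have hcont : ∀ r : ι → ℝ,
        IntervalIntegrable (fun t => hingeSum r t / t) MeasureTheory.volume m 1 := by
      intro r
      simp only [hingeSum, Finset.sum_div]
      have hsum := IntervalIntegrable.sum (f := fun i t => max (r i - t) 0 / t) univ fun i _ =>
        intervalIntegrable_hinge_div hm le_rfl hm1 (r i)
      rwa [Finset.sum_fn] at hsum
    have hle : ∫ t in m..1, hingeSum p t / t ≤ ∫ t in m..1, hingeSum q t / t := by
      refine intervalIntegral.integral_mono_on hm1 (hcont p) (hcont q) fun t ht => ?_
      exact div_le_div_of_nonneg_right (h t) (hm.trans_le ht.1).le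
    have h1 : ∑ i, p i * Real.log (p i) ≤
        ∑ i, ((∫ t in m..1, max (p i - t) 0 / t) + p i * (Real.log m + 1)) :=
      Finset.sum_le_sum fun i _ => mul_log_le_integral_hinge hm hm1 (hp.1 i) (hp.le_one i)
    have h2 : ∑ i, ((∫ t in m..1, max (q i - t) 0 / t) + q i * (Real.log m + 1)) ≤
        ∑ i, (q i * Real.log (q i) + m) :=
      Finset.sum_le_sum fun i _ => integral_hinge_le_mul_log hm hm1 (hq.1 i) (hq.le_one i)
    rw [Finset.sum_add_distrib, ← Finset.sum_mul, hp.2, hF] at h1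
    rw [Finset.sum_add_distrib, ← Finset.sum_mul, hq.2, hF, Finset.sum_add_distrib,
      Finset.sum_const, Finset.card_univ, nsmul_eq_mul] at h2
    linarith
  refine neg_le_neg (le_of_forall_pos_le_add fun ε hε => ?_)
  set N : ℝ := (Fintype.card ι : ℝ)
  have hN0 : 0 ≤ N := by positivity
  have hm : 0 < min 1 (ε / (N + 1)) := lt_min one_pos (by positivity)
  have h3 : N * min 1 (ε / (N + 1)) ≤ ε := by
    calc N * min 1 (ε / (N + 1)) ≤ (N + 1) * (ε / (N + 1)) :=
          mul_le_mul (by linarith) (min_le_right _ _) hm.le (by linarith)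
      _ = ε := mul_div_cancel₀ _ (by positivity)
  linarith [key _ hm (min_le_left _ _)]

lemma shannon_eq_sum_negMulLog {ι : Type*} [Fintype ι] (p : ι → ℝ) :
    shannon p = ∑ i, Real.negMulLog (p i) := by
  simp [shannon, Real.negMulLog]

lemma IsProbVec.tensor {ι κ : Type*} [Fintype ι] [Fintype κ] {p : ι → ℝ} {r : κ → ℝ}
    (hp : IsProbVec p) (hr : IsProbVec r) : IsProbVec (tensor p r) := by
  refine ⟨fun x => mul_nonneg (hp.1 _) (hr.1 _), ?_⟩
  simp only [_root_.tensor, Fintype.sum_prod_type, ← Finset.mul_sum, hr.2, mul_one, hp.2]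

lemma shannon_tensor {ι κ : Type*} [Fintype ι] [Fintype κ] {p : ι → ℝ} {r : κ → ℝ}
    (hp : IsProbVec p) (hr : IsProbVec r) : shannon (tensor p r) = shannon p + shannon r := by
  simp only [shannon_eq_sum_negMulLog, tensor, Fintype.sum_prod_type, Real.negMulLog_mul,
    Finset.sum_add_distrib, ← Finset.mul_sum, ← Finset.sum_mul, hr.2, hp.2, one_mul]

/-- Subadditivity of the Shannon entropy. -/
lemma shannon_le_add_marginals {ι κ : Type*} [Fintype ι] [Fintype κ] {r : ι × κ → ℝ}
    (hr : IsProbVec r) :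
    shannon r ≤ shannon (fun i => ∑ j, r (i, j)) + shannon (fun j => ∑ i, r (i, j)) := by
  set a : ι → ℝ := fun i => ∑ j, r (i, j) with ha
  set b : κ → ℝ := fun j => ∑ i, r (i, j) with hb
  have hsum_a : ∑ i, a i = 1 := by rw [← hr.2, Fintype.sum_prod_type]
  have hsum_b : ∑ j, b j = 1 := by rw [← hr.2, Fintype.sum_prod_type_right]
  have hA : ∑ i, a i * Real.log (a i) = ∑ i, ∑ j, r (i, j) * Real.log (a i) := by
    simp only [← Finset.sum_mul]; rfl
  have hB : ∑ j, b j * Real.log (b j) = ∑ i, ∑ j, r (i, j) * Real.log (b j) := by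
    rw [Finset.sum_comm]; simp only [← Finset.sum_mul]; rfl
  have hR : ∑ x, r x * Real.log (r x) = ∑ i, ∑ j, r (i, j) * Real.log (r (i, j)) :=
    Fintype.sum_prod_type _
  have key : ∀ i j, r (i, j) * Real.log (a i) + r (i, j) * Real.log (b j)
      - r (i, j) * Real.log (r (i, j)) ≤ a i * b j - r (i, j) := by
    intro i j
    have hra : r (i, j) ≤ a i :=
      Finset.single_le_sum (f := fun j => r (i, j)) (fun j _ => hr.1 _) (Finset.mem_univ j)
    have hrb : r (i, j) ≤ b j :=
      Finset.single_le_sum (f := fun i => r (i, j)) (fun i _ => hr.1 _) (Finset.mem_univ i)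
    rcases (hr.1 (i, j)).eq_or_lt with h0 | h0
    · rw [← h0] at hra hrb ⊢
      simpa using mul_nonneg hra hrb
    · have hab : 0 < a i * b j := mul_pos (h0.trans_le hra) (h0.trans_le hrb)
      have h1 := Real.log_le_sub_one_of_pos (div_pos hab h0)
      rw [Real.log_div hab.ne' h0.ne', Real.log_mul (h0.trans_le hra).ne'
        (h0.trans_le hrb).ne'] at h1
      have h2 := mul_le_mul_of_nonneg_left h1 h0.le
      rw [mul_sub (r (i, j)) (_ / _), mul_div_cancel₀ _ h0.ne'] at h2
      linarith
  have htot := Finset.sum_le_sum fun i (_ : i ∈ univ) =>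
    Finset.sum_le_sum fun j (_ : j ∈ univ) => key i j
  simp only [Finset.sum_sub_distrib, Finset.sum_add_distrib] at htot
  rw [← hA, ← hB, ← hR] at htot
  simp only [← Finset.mul_sum, ← Finset.sum_mul] at htot
  rw [hsum_b, mul_one, hsum_a] at htot
  simp only [shannon]
  linarith

lemma isProbVec_marg₁ {m₁ m₂ m₃ : ℕ} {r : Fin m₁ × Fin m₂ × Fin m₃ → ℝ} (hr : IsProbVec r) :
    IsProbVec (marg₁ r) := by
  refine ⟨fun i => Finset.sum_nonneg fun j _ => Finset.sum_nonneg fun k _ => hr.1 _, ?_⟩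
  rw [← hr.2]
  simp only [marg₁, Fintype.sum_prod_type]

lemma isProbVec_marg₂ {m₁ m₂ m₃ : ℕ} {r : Fin m₁ × Fin m₂ × Fin m₃ → ℝ} (hr : IsProbVec r) :
    IsProbVec (marg₂ r) := by
  refine ⟨fun i => Finset.sum_nonneg fun j _ => Finset.sum_nonneg fun k _ => hr.1 _, ?_⟩
  rw [← hr.2]
  simp only [marg₂, Fintype.sum_prod_type]
  exact Finset.sum_comm

lemma isProbVec_marg₃ {m₁ m₂ m₃ : ℕ} {r : Fin m₁ × Fin m₂ × Fin m₃ → ℝ} (hr : IsProbVec r) :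
    IsProbVec (marg₃ r) := by
  refine ⟨fun i => Finset.sum_nonneg fun j _ => Finset.sum_nonneg fun k _ => hr.1 _, ?_⟩
  rw [← hr.2]
  simp only [marg₃, Fintype.sum_prod_type]
  rw [Finset.sum_comm]
  exact Finset.sum_congr rfl fun i _ => Finset.sum_comm

lemma isProbVec_prodMarg {m₁ m₂ m₃ : ℕ} {r : Fin m₁ × Fin m₂ × Fin m₃ → ℝ}
    (hr : IsProbVec r) : IsProbVec (prodMarg r) :=
  (isProbVec_marg₁ hr).tensor ((isProbVec_marg₂ hr).tensor (isProbVec_marg₃ hr))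

lemma shannon_le_shannon_prodMarg {m₁ m₂ m₃ : ℕ} {r : Fin m₁ × Fin m₂ × Fin m₃ → ℝ}
    (hr : IsProbVec r) : shannon r ≤ shannon (prodMarg r) := by
  have h0 : shannon (prodMarg r) = shannon (marg₁ r) + (shannon (marg₂ r) + shannon (marg₃ r)) := by
    rw [← shannon_tensor (isProbVec_marg₂ hr) (isProbVec_marg₃ hr), ← shannon_tensor
      (isProbVec_marg₁ hr) ((isProbVec_marg₂ hr).tensor (isProbVec_marg₃ hr))]
    rfl
  have h1 := shannon_le_add_marginals hr
  have hB : IsProbVec (fun x : Fin m₂ × Fin m₃ => ∑ i, r (i, x)) := by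
    refine ⟨fun x => Finset.sum_nonneg fun i _ => hr.1 _, ?_⟩
    exact (Fintype.sum_prod_type_right r).symm.trans hr.2
  have h2 := shannon_le_add_marginals hB
  have e1 : (fun i => ∑ x, r (i, x)) = marg₁ r := by
    funext i
    simp only [marg₁, Fintype.sum_prod_type]
  have e2 : (fun j => ∑ k, ∑ i, r (i, j, k)) = marg₂ r := funext fun j => Finset.sum_comm
  have e3 : (fun k => ∑ j, ∑ i, r (i, j, k)) = marg₃ r := funext fun j => Finset.sum_comm
  rw [e1] at h1
  rw [e2, e3] at h2
  linarith

lemma shannon_le_of_maj_tensor {d m₁ m₂ m₃ : ℕ} {p q : Fin d → ℝ} (hp : IsProbVec p)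
    (hq : IsProbVec q) {r : Fin m₁ × Fin m₂ × Fin m₃ → ℝ} (hr : IsProbVec r)
    (h : Maj (tensor p r) (tensor q (prodMarg r))) : shannon q ≤ shannon p := by
  have h1 := shannon_le_of_hingeSum_le (hp.tensor hr) (hq.tensor (isProbVec_prodMarg hr))
    h.hingeSum_le
  rw [shannon_tensor hp hr, shannon_tensor hq (isProbVec_prodMarg hr)] at h1
  linarith [shannon_le_shannon_prodMarg hr]

lemma continuous_shannon {ι : Type*} [Fintype ι] :
    Continuous (shannon : (ι → ℝ) → ℝ) := by
  have : (shannon : (ι → ℝ) → ℝ) = fun p => ∑ i, Real.negMulLog (p i) :=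
    funext shannon_eq_sum_negMulLog
  rw [this]
  fun_prop

lemma le_shannon_of_forall_approx {ι : Type*} [Fintype ι] {p : ι → ℝ} {h : ℝ}
    (H : ∀ ε : ℝ, 0 < ε → ∃ p' : ι → ℝ, (∑ i, |p' i - p i| < ε) ∧ h ≤ shannon p') :
    h ≤ shannon p := by
  by_contra! hlt
  obtain ⟨δ, hδ, hball⟩ := Metric.eventually_nhds_iff.mp
    ((continuous_shannon.tendsto p).eventually (gt_mem_nhds hlt))
  obtain ⟨p', hclose, hle⟩ := H δ hδ
  refine absurd (hball ?_) (not_lt.mpr hle)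
  rw [dist_pi_lt_iff hδ]
  intro i
  rw [Real.dist_eq]
  exact (Finset.single_le_sum (f := fun i => |p' i - p i|) (fun i _ => abs_nonneg _)
    (Finset.mem_univ i)).trans_lt hclose

/-- A distribution other than the uniform one can be approximated by distributions of strictly
larger entropy. -/
lemma exists_approx_shannon_lt {ι : Type*} [Fintype ι] {p : ι → ℝ} (hp : IsProbVec p)
    (hne : ∃ i, p i ≠ (Fintype.card ι : ℝ)⁻¹) {ε : ℝ} (hε : 0 < ε) :
    ∃ p' : ι → ℝ, IsProbVec p' ∧ (∑ i, |p' i - p i| < ε) ∧ shannon p < shannon p' := by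
  obtain ⟨i₀, hi₀⟩ := hne
  have hcard : (0 : ℝ) < Fintype.card ι := by
    exact_mod_cast Fintype.card_pos_iff.mpr ⟨i₀⟩
  set u : ℝ := (Fintype.card ι : ℝ)⁻¹ with hu
  have hu0 : 0 < u := inv_pos.mpr hcard
  have hU : IsProbVec (fun _ : ι => u) := by
    refine ⟨fun _ => hu0.le, ?_⟩
    simp [hu, hcard.ne']
  have hmax : shannon p ≤ shannon (fun _ : ι => u) := by
    refine shannon_le_of_hingeSum_le hU hp fun t => ?_
    have := card_mul_hinge_average_le univ p t
    rw [hp.2, Finset.card_univ, one_div] at this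
    simpa [hingeSum] using this
  set D : ℝ := ∑ i, |u - p i| with hD
  have hD0 : 0 ≤ D := Finset.sum_nonneg fun i _ => abs_nonneg _
  obtain ⟨s, hs0, hs1, hsD⟩ : ∃ s : ℝ, 0 < s ∧ s < 1 ∧ s * D < ε := by
    refine ⟨min (1 / 2) (ε / (D + 1) / 2), by positivity, by
      exact (min_le_left _ _).trans_lt (by norm_num), ?_⟩
    calc min (1 / 2) (ε / (D + 1) / 2) * D ≤ (ε / (D + 1) / 2) * (D + 1) :=
          mul_le_mul (min_le_right _ _) (by linarith) hD0 (by positivity)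
      _ = ε / 2 := by field_simp
      _ < ε := by linarith
  refine ⟨fun i => (1 - s) * p i + s * u, ⟨fun i => ?_, ?_⟩, ?_, ?_⟩
  · have := hp.1 i
    have : 0 ≤ 1 - s := by linarith
    positivity
  · rw [Finset.sum_add_distrib, ← Finset.mul_sum, hp.2, ← Finset.mul_sum, hU.2]
    ring
  · calc ∑ i, |(1 - s) * p i + s * u - p i| = ∑ i, s * |u - p i| := by
          refine Finset.sum_congr rfl fun i _ => ?_
          rw [← abs_of_pos hs0, ← abs_mul, abs_of_pos hs0]
          congr 1
          ring
      _ = s * D := by rw [hD, Finset.mul_sum]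
      _ < ε := hsD
  · have hconc : ∑ i, ((1 - s) * Real.negMulLog (p i) + s * Real.negMulLog u) <
        ∑ i, Real.negMulLog ((1 - s) * p i + s * u) := by
      refine Finset.sum_lt_sum (fun i _ => ?_) ⟨i₀, Finset.mem_univ _, ?_⟩
      · exact Real.concaveOn_negMulLog.2 (hp.1 i) hu0.le (by linarith) hs0.le (by ring)
      · exact Real.strictConcaveOn_negMulLog.2 (hp.1 i₀) hu0.le hi₀ (by linarith) hs0 (by ring)
    rw [Finset.sum_add_distrib, ← Finset.mul_sum, ← Finset.mul_sum, ← shannon_eq_sum_negMulLog,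
      ← shannon_eq_sum_negMulLog (fun _ : ι => u), ← shannon_eq_sum_negMulLog] at hconc
    nlinarith

/-- The `n`-fold product distribution of `p`. -/
noncomputable def iidVec {ι : Type*} (p : ι → ℝ) (n : ℕ) : (Fin n → ι) → ℝ :=
  fun x => ∏ i, p (x i)

lemma IsProbVec.iidVec {ι : Type*} [Fintype ι] {p : ι → ℝ} (hp : IsProbVec p) (n : ℕ) :
    IsProbVec (iidVec p n) := by
  refine ⟨fun x => Finset.prod_nonneg fun i _ => hp.1 _, ?_⟩
  simp only [_root_.iidVec, ← Fintype.sum_pow, hp.2, one_pow]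

lemma sum_fin_succ_fun {ι : Type*} [Fintype ι] {n : ℕ} (F : (Fin (n + 1) → ι) → ℝ) :
    ∑ x, F x = ∑ a, ∑ y : Fin n → ι, F (Fin.cons a y) := by
  rw [← Fintype.sum_prod_type', ← (Fin.consEquiv fun _ => ι).sum_comp]
  rfl

lemma sum_iidVec_mul_sum {ι : Type*} [Fintype ι] {p : ι → ℝ} (hp : IsProbVec p) {g : ι → ℝ}
    (hg : ∑ a, p a * g a = 0) (n : ℕ) :
    ∑ x, iidVec p n x * ∑ i, g (x i) = 0 := by
  induction n with
  | zero => simp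
  | succ n ih =>
    have hsum := (hp.iidVec n).2
    rw [sum_fin_succ_fun]
    calc _ = ∑ a, (p a * g a * ∑ y, iidVec p n y
          + p a * ∑ y, iidVec p n y * ∑ i, g (y i)) := by
          refine Finset.sum_congr rfl fun a _ => ?_
          rw [Finset.mul_sum, Finset.mul_sum, ← Finset.sum_add_distrib]
          refine Finset.sum_congr rfl fun y _ => ?_
          simp only [iidVec, Fin.prod_univ_succ, Fin.sum_univ_succ, Fin.cons_zero, Fin.cons_succ]
          ring
      _ = 0 := by simp [ih, hsum, hg]

lemma sum_iidVec_mul_sum_sq {ι : Type*} [Fintype ι] {p : ι → ℝ} (hp : IsProbVec p) {g : ι → ℝ}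
    (hg : ∑ a, p a * g a = 0) (n : ℕ) :
    ∑ x, iidVec p n x * (∑ i, g (x i)) ^ 2 = n * ∑ a, p a * g a ^ 2 := by
  induction n with
  | zero => simp
  | succ n ih =>
    have hsum := (hp.iidVec n).2
    rw [sum_fin_succ_fun]
    calc _ = ∑ a, (p a * g a ^ 2 * ∑ y, iidVec p n y
          + 2 * (p a * g a) * ∑ y, iidVec p n y * ∑ i, g (y i)
          + p a * ∑ y, iidVec p n y * (∑ i, g (y i)) ^ 2) := by
          refine Finset.sum_congr rfl fun a _ => ?_
          rw [Finset.mul_sum, Finset.mul_sum, Finset.mul_sum, ← Finset.sum_add_distrib,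
            ← Finset.sum_add_distrib]
          refine Finset.sum_congr rfl fun y _ => ?_
          simp only [iidVec, Fin.prod_univ_succ, Fin.sum_univ_succ, Fin.cons_zero, Fin.cons_succ]
          ring
      _ = _ := by
          rw [ih, hsum, sum_iidVec_mul_sum hp hg]
          simp only [mul_one, mul_zero, add_zero, Finset.sum_add_distrib, ← Finset.sum_mul, hp.2]
          push_cast
          ring

/-- The weak law of large numbers for finite distributions. -/
lemma eventually_sum_deviation_le {ι : Type*} [Fintype ι] {p : ι → ℝ} (hp : IsProbVec p)
    (g : ι → ℝ) {η δ : ℝ} (hη : 0 < η) (hδ : 0 < δ) :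
    ∀ᶠ n : ℕ in Filter.atTop,
      ∑ x : Fin n → ι with n * η ≤ |∑ i, g (x i) - n * ∑ a, p a * g a|, iidVec p n x ≤ δ := by
  set μ : ℝ := ∑ a, p a * g a with hμ
  have hmean : ∑ a, p a * (g a - μ) = 0 := by
    simp only [mul_sub, Finset.sum_sub_distrib, ← Finset.sum_mul, hp.2]
    rw [← hμ, one_mul, sub_self]
  set V : ℝ := ∑ a, p a * (g a - μ) ^ 2 with hV
  filter_upwards [Filter.eventually_gt_atTop 0,
    (tendsto_natCast_atTop_atTop (R := ℝ)).eventually_ge_atTop (V / (η ^ 2 * δ))] with n hn hnV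
  have hn' : (0 : ℝ) < n := by exact_mod_cast hn
  have h2 := sum_iidVec_mul_sum_sq hp hmean n
  rw [← hV] at h2
  have h3 : (∑ x : Fin n → ι with n * η ≤ |∑ i, g (x i) - n * μ|, iidVec p n x) * (n * η) ^ 2
      ≤ n * V := by
    rw [← h2, Finset.sum_mul]
    refine (Finset.sum_le_sum fun x hx => ?_).trans (Finset.sum_le_sum_of_subset_of_nonneg
      (Finset.filter_subset _ _) fun x _ _ => mul_nonneg ((hp.iidVec n).1 x) (sq_nonneg _))
    refine mul_le_mul_of_nonneg_left ?_ ((hp.iidVec n).1 x)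
    have e : ∑ i, (g (x i) - μ) = ∑ i, g (x i) - n * μ := by
      simp [Finset.sum_sub_distrib]
    rw [e, sq_le_sq, abs_of_pos (by positivity)]
    exact (Finset.mem_filter.mp hx).2
  rw [div_le_iff₀ (by positivity)] at hnV
  refine le_of_mul_le_mul_right (h3.trans ?_) (show 0 < (n * η) ^ 2 by positivity)
  nlinarith

lemma log_iidVec {ι : Type*} {p : ι → ℝ} {n : ℕ} {x : Fin n → ι} (hx : iidVec p n x ≠ 0) :
    Real.log (iidVec p n x) = ∑ i, Real.log (p (x i)) := by
  refine Real.log_prod fun i _ h => hx ?_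
  exact Finset.prod_eq_zero (Finset.mem_univ i) h

/-- Most of the mass of an i.i.d. source sits on a set whose size has exponential rate at most
slightly above the entropy. -/
lemma eventually_exists_small_set {ι : Type*} [Fintype ι] {q : ι → ℝ} (hq : IsProbVec q)
    {η δ : ℝ} (hη : 0 < η) (hδ : 0 < δ) :
    ∀ᶠ n : ℕ in Filter.atTop, ∃ A : Finset (Fin n → ι),
      1 - δ ≤ ∑ x ∈ A, iidVec q n x ∧ (A.card : ℝ) ≤ Real.exp (n * (shannon q + η)) := by
  classical
  filter_upwards [eventually_sum_deviation_le hq (fun a => Real.log (q a)) hη hδ] with n hn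
  have hμ : ∑ a, q a * Real.log (q a) = -shannon q := by simp [shannon]
  rw [hμ] at hn
  refine ⟨univ.filter fun x => Real.exp (-(n * (shannon q + η))) ≤ iidVec q n x, ?_, ?_⟩
  · have hcompl : ∑ x : Fin n → ι with ¬ Real.exp (-(n * (shannon q + η))) ≤ iidVec q n x,
        iidVec q n x ≤ δ := by
      refine le_trans ?_ hn
      rw [Finset.sum_filter, Finset.sum_filter]
      refine Finset.sum_le_sum fun x _ => ?_
      have hx0 := (hq.iidVec n).1 x
      split_ifs with h1 h2 h2
      · exact hx0
      · exact le_rfl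
      · exact le_rfl
      · rcases hx0.eq_or_lt with h0 | h0
        · exact h0.symm.le
        · refine absurd ?_ h2
          have h3 := Real.log_lt_log h0 (not_le.mp h1)
          rw [Real.log_exp, log_iidVec h0.ne'] at h3
          rw [abs_of_nonpos]
          all_goals nlinarith
    have htot := Finset.sum_filter_add_sum_filter_not univ
      (fun x => Real.exp (-(n * (shannon q + η))) ≤ iidVec q n x) (iidVec q n)
    rw [(hq.iidVec n).2] at htot
    linarith
  · set A : Finset (Fin n → ι) :=
      univ.filter fun x => Real.exp (-(n * (shannon q + η))) ≤ iidVec q n x with hA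
    have h1 : (A.card : ℝ) * Real.exp (-(n * (shannon q + η))) ≤ 1 := by
      rw [← (hq.iidVec n).2, ← nsmul_eq_mul, ← Finset.sum_const]
      refine (Finset.sum_le_sum fun x hx => (Finset.mem_filter.mp hx).2).trans
        (Finset.sum_le_sum_of_subset_of_nonneg (Finset.subset_univ _)
          fun x _ _ => (hq.iidVec n).1 x)
    rw [Real.exp_neg, ← div_eq_mul_inv, div_le_one (Real.exp_pos _)] at h1
    exact h1

lemma sum_union_le_sum_add_sum {α : Type*} [DecidableEq α] (s t : Finset α) {f : α → ℝ}
    (hf : ∀ x, 0 ≤ f x) : ∑ x ∈ s ∪ t, f x ≤ ∑ x ∈ s, f x + ∑ x ∈ t, f x := by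
  rw [← Finset.sum_union_inter]
  linarith [Finset.sum_nonneg fun x (_ : x ∈ s ∩ t) => hf x]

lemma sum_biUnion_le_sum {α κ : Type*} [DecidableEq α] (s : Finset κ) (C : κ → Finset α)
    {f : α → ℝ} (hf : ∀ x, 0 ≤ f x) : ∑ x ∈ s.biUnion C, f x ≤ ∑ a ∈ s, ∑ x ∈ C a, f x := by
  classical
  induction s using Finset.induction_on with
  | empty => simp
  | insert a s ha ih =>
    rw [Finset.biUnion_insert, Finset.sum_insert ha]
    exact (sum_union_le_sum_add_sum _ _ hf).trans (by linarith)

/-- The number of sequences whose letter frequencies are close to `p` has exponential rate at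
least slightly below the entropy. -/
lemma eventually_exists_large_set {ι : Type*} [Fintype ι] [DecidableEq ι] {p : ι → ℝ}
    (hp : IsProbVec p) {η ε : ℝ} (hη : 0 < η) (hε : 0 < ε) :
    ∀ᶠ n : ℕ in Filter.atTop, ∃ T : Finset (Fin n → ι),
      (∀ x ∈ T, ∀ a, |∑ i, (if x i = a then (1 : ℝ) else 0) - n * p a| < n * ε) ∧
      1 / 2 * Real.exp (n * (shannon p - η)) ≤ T.card := by
  set k : ℝ := (Fintype.card ι : ℝ) with hk
  have hk0 : 0 ≤ k := Nat.cast_nonneg _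
  have hδ : 0 < 1 / (2 * (k + 1)) := by positivity
  have hfreq : ∀ᶠ n : ℕ in Filter.atTop, ∀ a,
      ∑ x : Fin n → ι with n * ε ≤ |∑ i, (if x i = a then (1 : ℝ) else 0) - n * p a|,
        iidVec p n x ≤ 1 / (2 * (k + 1)) := by
    rw [Filter.eventually_all]
    intro a
    have := eventually_sum_deviation_le hp (fun b => if b = a then 1 else 0) hε hδ
    simpa using this
  filter_upwards [hfreq, eventually_sum_deviation_le hp (fun a => Real.log (p a)) hη hδ]
    with n hfreq hent
  have hμ : ∑ a, p a * Real.log (p a) = -shannon p := by simp [shannon]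
  rw [hμ] at hent
  set B : Finset (Fin n → ι) :=
    univ.filter fun x => n * η ≤ |∑ i, Real.log (p (x i)) - n * -shannon p| with hB
  set C : ι → Finset (Fin n → ι) := fun a =>
    univ.filter fun x => n * ε ≤ |∑ i, (if x i = a then (1 : ℝ) else 0) - n * p a| with hC
  set T : Finset (Fin n → ι) := (B ∪ univ.biUnion C)ᶜ with hT
  have hTB : ∀ x ∈ T, |∑ i, Real.log (p (x i)) - n * -shannon p| < n * η := by
    intro x hx
    rw [hT, Finset.mem_compl, Finset.mem_union, not_or] at hx
    simpa [hB] using hx.1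
  have hTC : ∀ x ∈ T, ∀ a, |∑ i, (if x i = a then (1 : ℝ) else 0) - n * p a| < n * ε := by
    intro x hx a
    rw [hT, Finset.mem_compl, Finset.mem_union, not_or] at hx
    by_contra! h
    exact hx.2 (Finset.mem_biUnion.mpr ⟨a, Finset.mem_univ _, by simpa [hC] using h⟩)
  refine ⟨T, hTC, ?_⟩
  have hnn := (hp.iidVec n).1
  have hcompl : ∑ x ∈ Tᶜ, iidVec p n x ≤ 1 / 2 := by
    rw [hT, compl_compl]
    have h1 := sum_union_le_sum_add_sum B (univ.biUnion C) hnn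
    have h2 : ∑ x ∈ univ.biUnion C, iidVec p n x ≤ ∑ a, ∑ x ∈ C a, iidVec p n x :=
      sum_biUnion_le_sum univ C hnn
    have h3 : ∑ a, ∑ x ∈ C a, iidVec p n x ≤ ∑ _a : ι, 1 / (2 * (k + 1)) :=
      Finset.sum_le_sum fun a _ => hfreq a
    rw [Finset.sum_const, Finset.card_univ, nsmul_eq_mul, ← hk] at h3
    have h4 : 1 / (2 * (k + 1)) + k * (1 / (2 * (k + 1))) = 1 / 2 := by
      field_simp
      ring
    linarith
  have hTsum : 1 / 2 ≤ ∑ x ∈ T, iidVec p n x := by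
    have := Finset.sum_add_sum_compl T (iidVec p n)
    rw [(hp.iidVec n).2] at this
    linarith
  have hTle : ∀ x ∈ T, iidVec p n x ≤ Real.exp (-(n * (shannon p - η))) := by
    intro x hx
    rcases (hnn x).eq_or_lt with h0 | h0
    · rw [← h0]; positivity
    · rw [← Real.log_le_iff_le_exp h0, log_iidVec h0.ne']
      have := (abs_lt.mp (hTB x hx)).2
      linarith
  have h5 := hTsum.trans (Finset.sum_le_sum hTle)
  rw [Finset.sum_const, nsmul_eq_mul, Real.exp_neg, ← div_eq_mul_inv,
    le_div_iff₀ (Real.exp_pos _)] at h5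
  exact h5

lemma exists_small_set_large_set {ι : Type*} [Fintype ι] [DecidableEq ι] {p q : ι → ℝ}
    (hp : IsProbVec p) (hq : IsProbVec q) (h : shannon q < shannon p) {ε : ℝ} (hε : 0 < ε) :
    ∃ (N : ℕ) (A T : Finset (Fin (N + 1) → ι)), A.card ≤ T.card ∧
      1 - ε ≤ ∑ x ∈ A, iidVec q (N + 1) x ∧
      ∀ x ∈ T, ∀ a, |∑ i, (if x i = a then (1 : ℝ) else 0) - (N + 1 : ℕ) * p a|
        < (N + 1 : ℕ) * ε := by
  set η : ℝ := (shannon p - shannon q) / 4 with hη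
  have hη0 : 0 < η := by rw [hη]; linarith
  have hlarge := (tendsto_natCast_atTop_atTop (R := ℝ)).eventually_ge_atTop (1 / (2 * η))
  obtain ⟨n, ⟨A, hA, hAc⟩, ⟨T, hT, hTc⟩, hn0, hn⟩ := ((eventually_exists_small_set hq hη0 hε).and
    ((eventually_exists_large_set hp hη0 hε).and
      ((Filter.eventually_gt_atTop 0).and hlarge))).exists
  obtain ⟨N, rfl⟩ := Nat.exists_eq_succ_of_ne_zero hn0.ne'
  refine ⟨N, A, T, ?_, hA, hT⟩
  set n : ℝ := ((N.succ : ℕ) : ℝ)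
  have hsplit : Real.exp (n * (shannon p - η)) =
      Real.exp (n * (2 * η)) * Real.exp (n * (shannon q + η)) := by
    rw [← Real.exp_add]
    congr 1
    rw [hη]
    ring
  have h2 : 2 ≤ Real.exp (n * (2 * η)) := by
    rw [div_le_iff₀ (by positivity)] at hn
    linarith [Real.add_one_le_exp (n * (2 * η))]
  have hpos := Real.exp_pos (n * (shannon q + η))
  rw [hsplit] at hTc
  have : (A.card : ℝ) ≤ T.card := by nlinarith
  exact_mod_cast this

lemma exists_perm_map_subset {α : Type*} [Fintype α] {A T : Finset α} (h : A.card ≤ T.card) :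
    ∃ τ : Equiv.Perm α, ∀ x ∈ A, τ x ∈ T := by
  classical
  obtain ⟨T', hT', hcard⟩ := Finset.exists_subset_card_eq h
  let e : {x // x ∈ A} ≃ {x // x ∈ T'} := Finset.equivOfCardEq hcard.symm
  exact ⟨e.extendSubtype, fun x hx => hT' (e.extendSubtype_mem x hx)⟩

/-- A distribution concentrated on a set `A` majorizes one concentrated, and uniform up to a small
error, on a given set `T` of at least the same size. -/
lemma exists_hingeSum_le_concentrated {α : Type*} [Fintype α] {Q : α → ℝ} (hQ : IsProbVec Q)
    {A T : Finset α} (h : A.card ≤ T.card) :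
    ∃ P : α → ℝ, IsProbVec P ∧ (∀ t, hingeSum P t ≤ hingeSum Q t) ∧
      ∑ x ∈ A, Q x ≤ ∑ x ∈ T, P x := by
  classical
  obtain ⟨τ, hτ⟩ := exists_perm_map_subset h
  set R : α → ℝ := fun x => Q (τ.symm x) with hR
  have hR0 : ∀ x, 0 ≤ R x := fun x => hQ.1 _
  set P : α → ℝ := fun x => if x ∈ T then (∑ y ∈ T, R y) / T.card else R x with hP
  have hPT : ∀ x ∈ T, P x = (∑ y ∈ T, R y) / T.card := fun x hx => if_pos hx
  have hPT' : ∀ x ∈ Tᶜ, P x = R x := fun x hx => if_neg (Finset.mem_compl.mp hx)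
  have hsumT : ∑ x ∈ T, P x = ∑ x ∈ T, R x := by
    rw [Finset.sum_congr rfl hPT, Finset.sum_const, nsmul_eq_mul]
    rcases T.eq_empty_or_nonempty with rfl | hT
    · simp
    · have : (T.card : ℝ) ≠ 0 := by exact_mod_cast (Finset.card_pos.mpr hT).ne'
      exact mul_div_cancel₀ _ this
  refine ⟨P, ⟨fun x => ?_, ?_⟩, fun t => ?_, ?_⟩
  · simp only [hP]
    split_ifs
    · exact div_nonneg (Finset.sum_nonneg fun y _ => hR0 y) (Nat.cast_nonneg _)
    · exact hR0 x
  · rw [← Finset.sum_add_sum_compl T, hsumT, Finset.sum_congr rfl hPT',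
      Finset.sum_add_sum_compl, ← hQ.2]
    exact τ.symm.sum_comp Q
  · have hQR : hingeSum Q t = ∑ x, max (R x - t) 0 :=
      (τ.symm.sum_comp fun x => max (Q x - t) 0).symm
    rw [hQR, hingeSum, ← Finset.sum_add_sum_compl T, ← Finset.sum_add_sum_compl T]
    refine add_le_add ?_ (Finset.sum_le_sum fun x hx => by rw [hPT' x hx])
    refine le_trans ?_ (card_mul_hinge_average_le T R t)
    rw [← nsmul_eq_mul, ← Finset.sum_const]
    exact Finset.sum_le_sum fun x hx => by rw [hPT x hx]
  · rw [hsumT]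
    calc ∑ x ∈ A, Q x = ∑ x ∈ A.map τ.toEmbedding, R x := by simp [hR]
      _ ≤ ∑ x ∈ T, R x := by
        refine Finset.sum_le_sum_of_subset_of_nonneg ?_ fun x _ _ => hR0 x
        intro x hx
        obtain ⟨y, hy, rfl⟩ := Finset.mem_map.mp hx
        exact hτ y hy

lemma sum_insertNth {ι : Type*} [Fintype ι] {N : ℕ} (j : Fin (N + 1)) (F : (Fin (N + 1) → ι) → ℝ) :
    ∑ a, ∑ y : Fin N → ι, F (j.insertNth a y) = ∑ x, F x := by
  rw [← Fintype.sum_prod_type', ← (Fin.insertNthEquiv (fun _ => ι) j).sum_comp]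
  rfl

section Catalyst

variable {ι : Type*} [Fintype ι] [DecidableEq ι]

/-- The transition weight at site `i` of the channel that keeps the first `k` letters and
resamples the remaining ones from `q`. -/
noncomputable def siteKernel (q : ι → ℝ) (k i : ℕ) (a b : ι) : ℝ :=
  if i < k then (if a = b then 1 else 0) else q b

/-- The distribution with the first `k` letters drawn from `P` and the remaining letters drawn
independently from `q`. -/
noncomputable def hybrid {n : ℕ} (q : ι → ℝ) (P : (Fin n → ι) → ℝ) (k : ℕ) :
    (Fin n → ι) → ℝ :=
  fun x => ∑ z, P z * ∏ i : Fin n, siteKernel q k i (z i) (x i)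

/-- The transition weight of the channel that keeps the letters before site `j`, discards the
letter at `j`, and resamples the letters after `j` from `q`. -/
noncomputable def puncturedKernel {N : ℕ} (q : ι → ℝ) (j : Fin (N + 1)) (z : Fin (N + 1) → ι)
    (y : Fin N → ι) : ℝ :=
  ∏ i, siteKernel q j (j.succAbove i) (z (j.succAbove i)) (y i)

lemma sum_siteKernel {q : ι → ℝ} (hq : IsProbVec q) (k i : ℕ) (a : ι) :
    ∑ b, siteKernel q k i a b = 1 := by
  by_cases h : i < k <;> simp [siteKernel, h, hq.2]

lemma sum_puncturedKernel {N : ℕ} {q : ι → ℝ} (hq : IsProbVec q) (j : Fin (N + 1))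
    (z : Fin (N + 1) → ι) : ∑ y, puncturedKernel q j z y = 1 := by
  simp only [puncturedKernel]
  rw [← Fintype.prod_sum fun i b => siteKernel q j (j.succAbove i) (z (j.succAbove i)) b]
  simp [sum_siteKernel hq]

lemma puncturedKernel_nonneg {N : ℕ} {q : ι → ℝ} (hq : IsProbVec q) (j : Fin (N + 1))
    (z : Fin (N + 1) → ι) (y : Fin N → ι) : 0 ≤ puncturedKernel q j z y := by
  refine Finset.prod_nonneg fun i _ => ?_
  rw [siteKernel]
  split_ifs
  exacts [zero_le_one, le_rfl, hq.1 _]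

lemma hybrid_insertNth {N : ℕ} (q : ι → ℝ) (P : (Fin (N + 1) → ι) → ℝ) (j : Fin (N + 1))
    (a : ι) (y : Fin N → ι) :
    hybrid q P j (j.insertNth a y) = q a * ∑ z, P z * puncturedKernel q j z y := by
  rw [hybrid, Finset.mul_sum]
  refine Finset.sum_congr rfl fun z _ => ?_
  rw [Fin.prod_univ_succAbove _ j]
  simp only [Fin.insertNth_apply_same, Fin.insertNth_apply_succAbove, puncturedKernel]
  rw [siteKernel, if_neg (lt_irrefl _)]
  ring

lemma hybrid_succ_insertNth {N : ℕ} (q : ι → ℝ) (P : (Fin (N + 1) → ι) → ℝ) (j : Fin (N + 1))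
    (a : ι) (y : Fin N → ι) :
    hybrid q P (j + 1) (j.insertNth a y) =
      ∑ z, P z * ((if z j = a then 1 else 0) * puncturedKernel q j z y) := by
  rw [hybrid]
  refine Finset.sum_congr rfl fun z _ => ?_
  rw [Fin.prod_univ_succAbove _ j]
  simp only [Fin.insertNth_apply_same, Fin.insertNth_apply_succAbove, puncturedKernel]
  congr 2
  · rw [siteKernel, if_pos (Nat.lt_succ_self _)]
  · refine Finset.prod_congr rfl fun i _ => ?_
    have hne : ((j.succAbove i : Fin (N + 1)) : ℕ) ≠ j := fun h =>
      Fin.succAbove_ne j i (Fin.ext h)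
    have hiff : ((j.succAbove i : Fin (N + 1)) : ℕ) < j + 1 ↔
        ((j.succAbove i : Fin (N + 1)) : ℕ) < j := by omega
    simp only [siteKernel, hiff]

lemma hybrid_zero {n : ℕ} (q : ι → ℝ) {P : (Fin n → ι) → ℝ} (hP : IsProbVec P) :
    hybrid q P 0 = iidVec q n := by
  funext x
  simp [hybrid, siteKernel, iidVec, ← Finset.sum_mul, hP.2]

lemma hybrid_self {n : ℕ} (q : ι → ℝ) (P : (Fin n → ι) → ℝ) : hybrid q P n = P := by
  funext x
  have h : ∀ z : Fin n → ι,
      ∏ i : Fin n, siteKernel q n i (z i) (x i) = if z = x then 1 else 0 := by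
    intro z
    simp only [siteKernel, Fin.is_lt, if_true]
    by_cases hz : z = x
    · simp [hz]
    · obtain ⟨i, hi⟩ := Function.ne_iff.mp hz
      rw [if_neg hz]
      exact Finset.prod_eq_zero (Finset.mem_univ i) (if_neg hi)
  simp [hybrid, h]

/-- If `P` is majorized by the i.i.d. distribution `iidVec q (N + 1)`, then there is a catalyst `c`
such that `q ⊗ c` majorizes a joint distribution whose marginals are the average one-letter
marginal of `P` and `c` itself. -/
lemma exists_correlated_catalyst {N : ℕ} {q : ι → ℝ} (hq : IsProbVec q)
    {P : (Fin (N + 1) → ι) → ℝ} (hP : IsProbVec P)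
    (h : ∀ t, hingeSum P t ≤ hingeSum (iidVec q (N + 1)) t) :
    ∃ (c : Fin (N + 1) × (Fin N → ι) → ℝ) (ρ : ι × (Fin (N + 1) × (Fin N → ι)) → ℝ),
      IsProbVec ρ ∧ (∀ y, ∑ a, ρ (a, y) = c y) ∧
      (∀ a, ∑ y, ρ (a, y) =
        ((N + 1 : ℕ) : ℝ)⁻¹ * ∑ z, P z * ∑ j, if z j = a then 1 else 0) ∧
      ∀ t, hingeSum ρ t ≤ hingeSum (tensor q c) t := by
  set s : ℝ := ((N + 1 : ℕ) : ℝ)⁻¹ with hs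
  have hs0 : 0 ≤ s := by positivity
  have hs1 : ((N + 1 : ℕ) : ℝ) * s = 1 := mul_inv_cancel₀ (by positivity)
  set c : Fin (N + 1) × (Fin N → ι) → ℝ :=
    fun y => s * ∑ z, P z * puncturedKernel q y.1 z y.2 with hc
  set ρ : ι × (Fin (N + 1) × (Fin N → ι)) → ℝ := fun x =>
    s * ∑ z, P z * ((if z x.2.1 = x.1 then 1 else 0) * puncturedKernel q x.2.1 z x.2.2) with hρ
  have hmarg : ∀ a, ∑ y, ρ (a, y) = s * ∑ z, P z * ∑ j, if z j = a then 1 else 0 := by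
    intro a
    have h1 : ∀ j, ∑ y, ρ (a, (j, y)) = s * ∑ z, P z * (if z j = a then 1 else 0) := by
      intro j
      simp only [hρ]
      rw [← Finset.mul_sum, Finset.sum_comm]
      congr 1
      refine Finset.sum_congr rfl fun z _ => ?_
      rw [← Finset.mul_sum]
      split_ifs <;> simp [sum_puncturedKernel hq]
    rw [Fintype.sum_prod_type, Finset.sum_congr rfl fun j _ => h1 j, ← Finset.mul_sum,
      Finset.sum_comm]
    simp only [← Finset.mul_sum]
  refine ⟨c, ρ, ⟨fun x => ?_, ?_⟩, fun y => ?_, hmarg, fun t => ?_⟩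
  · refine mul_nonneg hs0 (Finset.sum_nonneg fun z _ => mul_nonneg (hP.1 z) (mul_nonneg ?_
      (puncturedKernel_nonneg hq _ _ _)))
    split_ifs
    exacts [zero_le_one, le_rfl]
  · rw [Fintype.sum_prod_type]
    simp only [hmarg]
    rw [← Finset.mul_sum, Finset.sum_comm]
    have : ∀ z : Fin (N + 1) → ι,
        ∑ a, P z * ∑ j, (if z j = a then (1 : ℝ) else 0) = P z * ((N + 1 : ℕ) : ℝ) := by
      intro z
      rw [← Finset.mul_sum, Finset.sum_comm]
      simp
    simp only [this, ← Finset.sum_mul, hP.2]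
    linarith
  · simp only [hρ, hc, ← Finset.mul_sum]
    congr 1
    rw [Finset.sum_comm]
    refine Finset.sum_congr rfl fun z _ => ?_
    rw [← Finset.mul_sum, ← Finset.sum_mul]
    simp
  · set Φ : ℕ → ℝ := fun k => hingeSum (fun x => s * hybrid q P k x) t with hΦ
    have h1 : hingeSum ρ t = ∑ j : Fin (N + 1), Φ (j + 1) := by
      rw [hingeSum, Fintype.sum_prod_type]
      simp only [Fintype.sum_prod_type]
      rw [Finset.sum_comm]
      refine Finset.sum_congr rfl fun j _ => ?_
      simp only [hΦ, hingeSum]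
      rw [← sum_insertNth j]
      simp only [hybrid_succ_insertNth, hρ]
    have h2 : hingeSum (tensor q c) t = ∑ j : Fin (N + 1), Φ j := by
      rw [hingeSum, Fintype.sum_prod_type]
      simp only [Fintype.sum_prod_type]
      rw [Finset.sum_comm]
      refine Finset.sum_congr rfl fun j _ => ?_
      simp only [hΦ, hingeSum]
      rw [← sum_insertNth j]
      simp only [hybrid_insertNth, hc, tensor, mul_left_comm s]
    have h3 : Φ (N + 1) ≤ Φ 0 := by
      simp only [hΦ, hybrid_self, hybrid_zero q hP]
      exact hingeSum_mul_le h hs0 t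
    rw [h1, h2, Fin.sum_univ_eq_sum_range (fun j => Φ (j + 1)), Fin.sum_univ_eq_sum_range Φ,
      Finset.sum_range_succ, Finset.sum_range_succ' Φ]
    linarith

end Catalyst

/-- A conversion of `q ⊗ c` into a joint distribution with second marginal `c` turns into a
conversion that leaves the system uncorrelated, at the price of using a copy of the target as part
of the catalyst. -/
lemma exists_maj_tensor_prodMarg {d : ℕ} {κ : Type*} [Fintype κ] [Nonempty κ] (hd : 1 ≤ d)
    {q : Fin d → ℝ} (hq : IsProbVec q) {c : κ → ℝ} {ρ : Fin d × κ → ℝ} (hρ : IsProbVec ρ)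
    (hc : ∀ y, ∑ a, ρ (a, y) = c y) (h : ∀ t, hingeSum ρ t ≤ hingeSum (tensor q c) t) :
    IsProbVec (fun a => ∑ y, ρ (a, y)) ∧
    ∃ m₁ m₂ m₃ : ℕ, 1 ≤ m₁ ∧ 1 ≤ m₂ ∧ 1 ≤ m₃ ∧
      ∃ r : Fin m₁ × Fin m₂ × Fin m₃ → ℝ, IsProbVec r ∧
        Maj (tensor (fun a => ∑ y, ρ (a, y)) r) (tensor q (prodMarg r)) := by
  set p : Fin d → ℝ := fun a => ∑ y, ρ (a, y) with hp
  have hpp : IsProbVec p :=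
    ⟨fun a => Finset.sum_nonneg fun y _ => hρ.1 _, by rw [← hρ.2, Fintype.sum_prod_type]⟩
  have e := Fintype.equivFin κ
  set r : Fin d × Fin (Fintype.card κ) × Fin 1 → ℝ := fun x => ρ (x.1, e.symm x.2.1) with hr
  have hrp : IsProbVec r := by
    refine ⟨fun x => hρ.1 _, ?_⟩
    rw [← hρ.2]
    simp only [Fintype.sum_prod_type, hr, Finset.univ_unique, Finset.sum_singleton]
    exact Finset.sum_congr rfl fun a _ => e.symm.sum_comp fun y => ρ (a, y)
  have hm1 : marg₁ r = p := by
    funext a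
    simp only [marg₁, hr, Finset.univ_unique, Finset.sum_singleton]
    exact e.symm.sum_comp fun y => ρ (a, y)
  have hm2 : marg₂ r = fun j => c (e.symm j) := by
    funext j
    simp [marg₂, hr, hc]
  have hm3 : marg₃ r = fun _ => 1 := by
    funext k
    have h1 := (isProbVec_marg₃ hrp).2
    rw [Fin.sum_univ_one] at h1
    rw [Subsingleton.elim k 0, h1]
  refine ⟨hpp, d, Fintype.card κ, 1, hd, Fintype.card_pos, le_rfl, r, hrp, ?_⟩
  refine maj_of_hingeSum_le ?_ fun t => ?_
  · rw [(hpp.tensor hrp).2, (hq.tensor (isProbVec_prodMarg hrp)).2]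
  · have h1 : hingeSum (tensor p r) t = ∑ b, hingeSum (fun x => p b * ρ x) t := by
      simp only [hingeSum, tensor, Fintype.sum_prod_type, hr, Finset.univ_unique,
        Finset.sum_singleton]
      exact Finset.sum_congr rfl fun b _ => Finset.sum_congr rfl fun a _ =>
        e.symm.sum_comp fun y => max (p b * ρ (a, y) - t) 0
    have h2 : hingeSum (tensor q (prodMarg r)) t =
        ∑ b, hingeSum (fun x => p b * tensor q c x) t := by
      simp only [hingeSum, tensor, prodMarg, hm1, hm2, hm3, Fintype.sum_prod_type,
        Finset.univ_unique, Finset.sum_singleton, mul_one]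
      rw [Finset.sum_comm]
      refine Finset.sum_congr rfl fun b _ => Finset.sum_congr rfl fun a _ => ?_
      rw [← e.symm.sum_comp fun y => max (p b * (q a * c y) - t) 0]
      simp only [mul_left_comm (q a)]
    rw [h1, h2]
    exact Finset.sum_le_sum fun b _ => hingeSum_mul_le h (hpp.1 b) t

/-- The average letter frequency of `P` is close to `p` if `P` is concentrated on sequences with
letter frequencies close to `p`. -/
lemma sum_abs_average_freq_sub_le {ι : Type*} [Fintype ι] [DecidableEq ι] {p : ι → ℝ}
    (hp : IsProbVec p) {N : ℕ} {P : (Fin (N + 1) → ι) → ℝ} (hP : IsProbVec P)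
    {T : Finset (Fin (N + 1) → ι)} {ε : ℝ} (hε : 0 < ε) (hPT : 1 - ε ≤ ∑ x ∈ T, P x)
    (hT : ∀ x ∈ T, ∀ a, |∑ i, (if x i = a then (1 : ℝ) else 0) - (N + 1 : ℕ) * p a|
        < (N + 1 : ℕ) * ε) :
    ∑ a, |((N + 1 : ℕ) : ℝ)⁻¹ * ∑ z, P z * ∑ j, (if z j = a then 1 else 0) - p a| ≤
      (Fintype.card ι + 2) * ε := by
  set n : ℝ := ((N + 1 : ℕ) : ℝ) with hn
  have hn0 : 0 < n := by positivity
  set f : (Fin (N + 1) → ι) → ι → ℝ := fun z a =>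
    n⁻¹ * ∑ j, (if z j = a then 1 else 0) with hf
  have hf0 : ∀ z a, 0 ≤ f z a := by
    intro z a
    refine mul_nonneg (inv_nonneg.mpr hn0.le) (Finset.sum_nonneg fun j _ => ?_)
    split_ifs
    exacts [zero_le_one, le_rfl]
  have hf1 : ∀ z, ∑ a, f z a = 1 := by
    intro z
    simp only [hf, ← Finset.mul_sum]
    rw [Finset.sum_comm]
    have : ∑ j : Fin (N + 1), ∑ a, (if z j = a then (1 : ℝ) else 0) = n := by simp [hn]
    rw [this, inv_mul_cancel₀ hn0.ne']
  have hdev : ∀ z, ∑ a, |f z a - p a| ≤ 2 := by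
    intro z
    calc ∑ a, |f z a - p a| ≤ ∑ a, (f z a + p a) := by
          refine Finset.sum_le_sum fun a _ => abs_le.mpr ?_
          constructor <;> linarith [hf0 z a, hp.1 a]
      _ = 2 := by rw [Finset.sum_add_distrib, hf1, hp.2]; norm_num
  have hdevT : ∀ z ∈ T, ∑ a, |f z a - p a| ≤ Fintype.card ι * ε := by
    intro z hz
    rw [← nsmul_eq_mul, ← Finset.card_univ, ← Finset.sum_const]
    refine Finset.sum_le_sum fun a _ => ?_
    have h1 := hT z hz a
    have h2 : ∑ i, (if z i = a then (1 : ℝ) else 0) - n * p a = n * (f z a - p a) := by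
      simp only [hf]
      rw [mul_sub, mul_inv_cancel_left₀ hn0.ne']
    rw [h2, abs_mul, abs_of_pos hn0] at h1
    exact (lt_of_mul_lt_mul_left h1 hn0.le).le
  have hmain : ∑ a, |n⁻¹ * ∑ z, P z * ∑ j, (if z j = a then 1 else 0) - p a| ≤
      ∑ z, P z * ∑ a, |f z a - p a| := by
    simp only [Finset.mul_sum (s := (univ : Finset ι))]
    rw [Finset.sum_comm]
    refine Finset.sum_le_sum fun a _ => ?_
    have h1 : n⁻¹ * ∑ z, P z * ∑ j, (if z j = a then 1 else 0) - p a =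
        ∑ z, P z * (f z a - p a) := by
      simp only [mul_sub, Finset.sum_sub_distrib, ← Finset.sum_mul, hP.2, one_mul]
      congr 1
      rw [Finset.mul_sum]
      exact Finset.sum_congr rfl fun z _ => mul_left_comm _ _ _
    rw [h1]
    refine (Finset.abs_sum_le_sum_abs _ _).trans (le_of_eq ?_)
    exact Finset.sum_congr rfl fun z _ => by rw [abs_mul, abs_of_nonneg (hP.1 z)]
  have hcompl := Finset.sum_add_sum_compl T P
  rw [hP.2] at hcompl
  have hPT1 : ∑ x ∈ T, P x ≤ 1 := by
    linarith [Finset.sum_nonneg fun x (_ : x ∈ Tᶜ) => hP.1 x]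
  refine hmain.trans ?_
  rw [← Finset.sum_add_sum_compl T]
  have h1 : ∑ z ∈ T, P z * ∑ a, |f z a - p a| ≤ (∑ z ∈ T, P z) * (Fintype.card ι * ε) := by
    rw [Finset.sum_mul]
    exact Finset.sum_le_sum fun z hz => mul_le_mul_of_nonneg_left (hdevT z hz) (hP.1 z)
  have h2 : ∑ z ∈ Tᶜ, P z * ∑ a, |f z a - p a| ≤ (∑ z ∈ Tᶜ, P z) * 2 := by
    rw [Finset.sum_mul]
    exact Finset.sum_le_sum fun z _ => mul_le_mul_of_nonneg_left (hdev z) (hP.1 z)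
  have h3 : 0 ≤ (Fintype.card ι : ℝ) * ε := by positivity
  nlinarith

lemma exists_approx_conversion_of_shannon_lt {d : ℕ} {p q : Fin d → ℝ} (hp : IsProbVec p)
    (hq : IsProbVec q) (h : shannon q < shannon p) {ε : ℝ} (hε : 0 < ε) :
    ∃ p' : Fin d → ℝ, IsProbVec p' ∧ (∑ i, |p' i - p i| < ε) ∧
      ∃ m₁ m₂ m₃ : ℕ, 1 ≤ m₁ ∧ 1 ≤ m₂ ∧ 1 ≤ m₃ ∧
        ∃ r : Fin m₁ × Fin m₂ × Fin m₃ → ℝ, IsProbVec r ∧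
          Maj (tensor p' r) (tensor q (prodMarg r)) := by
  have hd : 1 ≤ d := by
    rcases Nat.eq_zero_or_pos d with rfl | hd
    · simp [shannon] at h
    · exact hd
  have : Nonempty (Fin d) := ⟨⟨0, hd⟩⟩
  have hε' : 0 < ε / (d + 3) := by positivity
  obtain ⟨N, A, T, hcard, hA, hT⟩ := exists_small_set_large_set hp hq h hε'
  obtain ⟨P, hP, hPq, hAT⟩ := exists_hingeSum_le_concentrated (hq.iidVec (N + 1)) hcard
  obtain ⟨c, ρ, hρ, hc, hmarg, hle⟩ := exists_correlated_catalyst hq hP hPq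
  obtain ⟨hp', hconv⟩ := exists_maj_tensor_prodMarg hd hq hρ hc hle
  refine ⟨_, hp', ?_, hconv⟩
  simp only [hmarg]
  refine (sum_abs_average_freq_sub_le hp hP hε' (hA.trans hAT) hT).trans_lt ?_
  rw [Fintype.card_fin, ← mul_div_assoc, div_lt_iff₀ (by positivity)]
  nlinarith

lemma exists_conversion_of_maj {d : ℕ} {p q : Fin d → ℝ} (h : Maj p q) :
    ∃ m₁ m₂ m₃ : ℕ, 1 ≤ m₁ ∧ 1 ≤ m₂ ∧ 1 ≤ m₃ ∧
      ∃ r : Fin m₁ × Fin m₂ × Fin m₃ → ℝ, IsProbVec r ∧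
        Maj (tensor p r) (tensor q (prodMarg r)) := by
  refine ⟨1, 1, 1, le_rfl, le_rfl, le_rfl, fun _ => 1, ⟨fun _ => zero_le_one, by simp⟩, ?_⟩
  refine maj_of_hingeSum_le ?_ fun t => ?_
  · simpa [tensor, prodMarg, marg₁, marg₂, marg₃, Fintype.sum_prod_type] using h.1
  · simpa [hingeSum, tensor, prodMarg, marg₁, marg₂, marg₃, Fintype.sum_prod_type]
      using h.hingeSum_le t

/-- ε-approximate version of the entanglement assisted coherence transformation
criterion: nonstrict decrease of the Shannon entropy is necessary and
sufficient. -/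
theorem approx_entanglement_assisted_conversion_iff
    (d : ℕ) (p q : Fin d → ℝ) (hp : IsProbVec p) (hq : IsProbVec q) :
    (∀ ε : ℝ, 0 < ε → ∃ p' : Fin d → ℝ, IsProbVec p' ∧ (∑ i, |p' i - p i| < ε) ∧
      ∃ m₁ m₂ m₃ : ℕ, 1 ≤ m₁ ∧ 1 ≤ m₂ ∧ 1 ≤ m₃ ∧
        ∃ r : Fin m₁ × Fin m₂ × Fin m₃ → ℝ, IsProbVec r ∧
          Maj (tensor p' r) (tensor q (prodMarg r)))
    ↔ shannon q ≤ shannon p := by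
  constructor
  · intro H
    refine le_shannon_of_forall_approx fun ε hε => ?_
    obtain ⟨p', hp', hclose, m₁, m₂, m₃, -, -, -, r, hr, hmaj⟩ := H ε hε
    exact ⟨p', hclose, shannon_le_of_maj_tensor hp' hq hr hmaj⟩
  · intro H ε hε
    by_cases hne : ∃ i, p i ≠ (Fintype.card (Fin d) : ℝ)⁻¹
    · obtain ⟨p', hp', hclose, hlt⟩ := exists_approx_shannon_lt hp hne (half_pos hε)
      obtain ⟨p'', hp'', hclose', hconv⟩ :=
        exists_approx_conversion_of_shannon_lt hp' hq (H.trans_lt hlt) (half_pos hε)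
      refine ⟨p'', hp'', ?_, hconv⟩
      calc ∑ i, |p'' i - p i| ≤ ∑ i, (|p'' i - p' i| + |p' i - p i|) :=
            Finset.sum_le_sum fun i _ => abs_sub_le _ _ _
        _ < ε := by
            rw [Finset.sum_add_distrib]
            linarith
    · push Not at hne
      refine ⟨p, hp, by simpa using hε, exists_conversion_of_maj ?_⟩
      refine maj_of_hingeSum_le (hp.2.trans hq.2.symm) fun t => ?_
      have hav := card_mul_hinge_average_le univ q t
      rw [hq.2, Finset.card_univ, one_div] at hav
      simpa [hingeSum, hne] using hav
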